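/- arXiv:1310.7063 — 2 statements merged into one kernel-verified Lean document; each statement's English description precedes it below -/
import Mathlib

section
/- (Theorem 3, strongly convex case, one-step recurrence) Suppose f := Σ_{i=1}^n f_i is strongly convex with modulus μ_f > 0, i.e., ⟨∇f(x_a) − ∇f(x_b), x_a − x_b⟩ ≥ μ_f ‖x_a − x_b‖² for all x_a, x_b ∈ ℝ^p. Set μ_f̄ := μ_f/n, c₁ := 1/(μ_f̄ + L_f̄), c₂ := μ_f̄ L_f̄/(μ_f̄ + L_f̄). If α ≤ min{(1 + λ_n(W))/L_h, c₁} and β < 1, then for every δ > 0 and all k ≥ 0: ‖ē(k+1)‖² ≤ (1 − α c₂ + α δ − α² δ c₂) ‖ē(k)‖² + α³ (α + δ⁻¹) L_h² D² / (1 − β)². -/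
open scoped RealInnerProductSpace

lemma aux_line {E : Type*} [NormedAddCommGroup E] [InnerProductSpace ℝ E] [CompleteSpace E]
    {f : E → ℝ} {g : E → E} (hg : ∀ z, HasGradientAt f (g z) z) (x d : E) (t : ℝ) :
    HasDerivAt (fun t : ℝ => f (x + t • d)) ⟪g (x + t • d), d⟫ t := by
  have h1 : HasDerivAt (fun t : ℝ => x + t • d) d t := by
    simpa using ((hasDerivAt_id t).smul_const d).const_add x
  have h2 := (hg (x + t • d)).hasFDerivAt.comp_hasDerivAt t h1
  simpa [Function.comp_def] using h2

lemma aux_descent {E : Type*} [NormedAddCommGroup E] [InnerProductSpace ℝ E] [CompleteSpace E]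
    {f : E → ℝ} {g : E → E} (hg : ∀ z, HasGradientAt f (g z) z) {L : ℝ}
    (hL : ∀ a b, ‖g a - g b‖ ≤ L * ‖a - b‖) (x d : E) :
    f (x + d) ≤ f x + ⟪g x, d⟫ + L / 2 * ‖d‖ ^ 2 := by
  have hder : ∀ t : ℝ, HasDerivAt
      (fun t : ℝ => f (x + t • d) - (t * ⟪g x, d⟫ + L / 2 * ‖d‖ ^ 2 * t ^ 2))
      (⟪g (x + t • d), d⟫ - (⟪g x, d⟫ + L / 2 * ‖d‖ ^ 2 * (2 * t))) t := by
    intro t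
    have h1 := ((hasDerivAt_id t).mul_const ⟪g x, d⟫).add
      (((hasDerivAt_id t).pow 2).const_mul (L / 2 * ‖d‖ ^ 2))
    have h2 := (aux_line hg x d t).sub h1
    refine h2.congr_deriv ?_
    simp
  have hanti : AntitoneOn (fun t : ℝ => f (x + t • d) - (t * ⟪g x, d⟫ + L / 2 * ‖d‖ ^ 2 * t ^ 2))
      (Set.Icc 0 1) := by
    refine antitoneOn_of_deriv_nonpos (convex_Icc 0 1)
      (fun t _ => (hder t).continuousAt.continuousWithinAt)
      (fun t _ => (hder t).differentiableAt.differentiableWithinAt) ?_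
    intro t ht
    rw [interior_Icc] at ht
    rw [(hder t).deriv]
    have h3 : ⟪g (x + t • d) - g x, d⟫ ≤ L * ‖t • d‖ * ‖d‖ := by
      refine (real_inner_le_norm _ _).trans ?_
      gcongr
      simpa using hL (x + t • d) x
    rw [inner_sub_left, norm_smul, Real.norm_of_nonneg ht.1.le] at h3
    nlinarith
  have := hanti (by simp : (0:ℝ) ∈ Set.Icc 0 1) (by simp : (1:ℝ) ∈ Set.Icc 0 1) zero_le_one
  simp at this
  linarith

lemma aux_grad_sq {E : Type*} [NormedAddCommGroup E] [InnerProductSpace ℝ E] [CompleteSpace E]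
    {f : E → ℝ} {g : E → E} (hg : ∀ z, HasGradientAt f (g z) z) {L : ℝ} (hLp : 0 < L)
    (hL : ∀ a b, ‖g a - g b‖ ≤ L * ‖a - b‖) (m : ℝ) (hm : ∀ z, m ≤ f z) (x : E) :
    ‖g x‖ ^ 2 ≤ 2 * L * (f x - m) := by
  have h := aux_descent hg hL x (-(L⁻¹ • g x))
  have h2 := hm (x + -(L⁻¹ • g x))
  rw [norm_neg, norm_smul, inner_neg_right, inner_smul_right, real_inner_self_eq_norm_sq,
    Real.norm_of_nonneg (by positivity)] at h
  have h3 : m ≤ f x - ‖g x‖ ^ 2 / (2 * L) := by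
    refine h2.trans (h.trans (le_of_eq ?_))
    field_simp
    ring
  have h4 : ‖g x‖ ^ 2 / (2 * L) ≤ f x - m := by linarith
  rw [div_le_iff₀ (by positivity)] at h4
  linarith

lemma aux_first_order {E : Type*} [NormedAddCommGroup E] [InnerProductSpace ℝ E] [CompleteSpace E]
    {f : E → ℝ} {g : E → E} (hg : ∀ z, HasGradientAt f (g z) z) (hc : ConvexOn ℝ Set.univ f)
    (x y : E) : f x + ⟪g x, y - x⟫ ≤ f y := by
  have hc' : ConvexOn ℝ Set.univ (fun t : ℝ => f (x + t • (y - x))) := by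
    refine ⟨convex_univ, fun a _ b _ s t hs ht hst => ?_⟩
    have := hc.2 (Set.mem_univ (x + a • (y - x))) (Set.mem_univ (x + b • (y - x))) hs ht hst
    refine le_trans (le_of_eq ?_) this
    simp only
    congr 1
    have : x = s • x + t • x := by rw [← add_smul, hst, one_smul]
    nth_rewrite 1 [this]
    simp only [smul_add, smul_smul, add_smul, smul_eq_mul]
    abel
  have := hc'.le_slope_of_hasDerivAt (Set.mem_univ 0) (Set.mem_univ 1) zero_lt_one
    (aux_line hg x (y - x) 0)
  simp [slope_def_field] at this
  linarith

lemma aux_cocoercive {E : Type*} [NormedAddCommGroup E] [InnerProductSpace ℝ E] [CompleteSpace E]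
    {f : E → ℝ} {g : E → E} (hg : ∀ z, HasGradientAt f (g z) z) {L : ℝ} (hLp : 0 < L)
    (hL : ∀ a b, ‖g a - g b‖ ≤ L * ‖a - b‖) (hc : ConvexOn ℝ Set.univ f) (x y : E)
    (hx : g x = 0) : ‖g y‖ ^ 2 ≤ L * ⟪g y, y - x⟫ := by
  have hmin : ∀ z, f x ≤ f z := fun z => by
    simpa [hx] using aux_first_order hg hc x z
  have h1 := aux_grad_sq hg hLp hL (f x) hmin y
  -- second: φ z = f z - ⟪g y, z⟫
  have hg2 : ∀ z, HasGradientAt (fun z => f z - ⟪g y, z⟫) (g z - g y) z := by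
    intro z
    have : HasFDerivAt (fun z => f z - ⟪g y, z⟫) _ z :=
      (hg z).hasFDerivAt.sub (innerSL ℝ (g y)).hasFDerivAt
    rw [hasGradientAt_iff_hasFDerivAt]
    refine this.congr_fderiv ?_
    ext w
    simp
  have h2 := aux_grad_sq hg2 hLp (fun a b => by simpa using hL a b) (f y - ⟪g y, y⟫)
    (fun z => by
      have := aux_first_order hg hc y z
      rw [inner_sub_right] at this
      linarith) x
  simp only [hx, zero_sub, norm_neg] at h2
  rw [inner_sub_right]
  nlinarith

lemma aux_eig_inner {n : ℕ} {W : Matrix (Fin n) (Fin n) ℝ} (hW : W.IsHermitian) (j : Fin n)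
    (u : EuclideanSpace ℝ (Fin n)) :
    ⟪hW.eigenvectorBasis j, Matrix.toEuclideanLin W u⟫
      = hW.eigenvalues j * ⟪hW.eigenvectorBasis j, u⟫ := by
  have hs := Matrix.isSymmetric_toEuclideanLin_iff.mpr hW
  rw [← hs]
  have : Matrix.toEuclideanLin W (hW.eigenvectorBasis j)
      = hW.eigenvalues j • hW.eigenvectorBasis j := by
    ext i
    have := congrFun (hW.mulVec_eigenvectorBasis j) i
    simpa [Matrix.toLpLin_apply] using this
  rw [this, inner_smul_left]
  simp

lemma aux_eig_quad {n : ℕ} {W : Matrix (Fin n) (Fin n) ℝ} (hW : W.IsHermitian)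
    (u : EuclideanSpace ℝ (Fin n)) :
    ⟪u, Matrix.toEuclideanLin W u⟫
      = ∑ j, hW.eigenvalues j * ⟪hW.eigenvectorBasis j, u⟫ ^ 2 := by
  rw [← hW.eigenvectorBasis.sum_inner_mul_inner]
  refine Finset.sum_congr rfl fun j _ => ?_
  rw [aux_eig_inner, real_inner_comm]
  ring

lemma aux_normsq {n : ℕ} {W : Matrix (Fin n) (Fin n) ℝ} (hW : W.IsHermitian)
    (u : EuclideanSpace ℝ (Fin n)) :
    ‖u‖ ^ 2 = ∑ j, ⟪hW.eigenvectorBasis j, u⟫ ^ 2 := by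
  rw [← real_inner_self_eq_norm_sq, ← hW.eigenvectorBasis.sum_inner_mul_inner]
  refine Finset.sum_congr rfl fun j _ => ?_
  rw [real_inner_comm]
  ring

lemma aux_quad_lower {n : ℕ} {W : Matrix (Fin n) (Fin n) ℝ} (hW : W.IsHermitian) (l : ℝ)
    (hl : ∀ j, l ≤ hW.eigenvalues j) (u : EuclideanSpace ℝ (Fin n)) :
    l * ‖u‖ ^ 2 ≤ ⟪u, Matrix.toEuclideanLin W u⟫ := by
  rw [aux_eig_quad hW, aux_normsq hW, Finset.mul_sum]
  gcongr
  exact hl _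

lemma aux_quad_upper {n : ℕ} {W : Matrix (Fin n) (Fin n) ℝ} (hW : W.IsHermitian) (l : ℝ)
    (hl : ∀ j, hW.eigenvalues j ≤ l) (u : EuclideanSpace ℝ (Fin n)) :
    ⟪u, Matrix.toEuclideanLin W u⟫ ≤ l * ‖u‖ ^ 2 := by
  rw [aux_eig_quad hW, aux_normsq hW, Finset.mul_sum]
  gcongr
  exact hl _

lemma aux_contract {n : ℕ} {W : Matrix (Fin n) (Fin n) ℝ} (hW : W.IsHermitian)
    (hWrow : ∀ i, ∑ j, W i j = 1) (β : ℝ) (hβ1 : β < 1) (j0 : Fin n)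
    (hβ : ∀ j, j ≠ j0 → |hW.eigenvalues j| ≤ β) (u : EuclideanSpace ℝ (Fin n))
    (hu : ∑ i, u i = 0) :
    ‖Matrix.toEuclideanLin W u‖ ^ 2 ≤ β ^ 2 * ‖u‖ ^ 2 := by
  set o : EuclideanSpace ℝ (Fin n) := WithLp.toLp 2 (fun _ => (1:ℝ)) with ho
  have hWo : Matrix.toEuclideanLin W o = o := by
    ext i
    simp [Matrix.toLpLin_apply, Matrix.mulVec, dotProduct, ho, hWrow]
  have hz : ∀ j, j ≠ j0 → ⟪hW.eigenvectorBasis j, o⟫ = 0 := by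
    intro j hj
    have h1 := aux_eig_inner hW j o
    rw [hWo] at h1
    have h2 := (abs_le.mp (hβ j hj)).2
    have : (hW.eigenvalues j - 1) * ⟪hW.eigenvectorBasis j, o⟫ = 0 := by linarith
    rcases mul_eq_zero.mp this with h | h
    · linarith
    · exact h
  have hou : ⟪o, u⟫ = 0 := by
    simp [PiLp.inner_apply, ho, hu]
  have h0 : ⟪hW.eigenvectorBasis j0, u⟫ = 0 := by
    rw [← hW.eigenvectorBasis.sum_inner_mul_inner, Finset.sum_eq_single j0] at hou
    · rcases mul_eq_zero.mp hou with h | h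
      · exfalso
        have h3 := aux_normsq hW o
        rw [Finset.sum_eq_zero] at h3
        · have h4 : o = 0 := by simpa using h3
          have h5 := congrArg (fun v : EuclideanSpace ℝ (Fin n) => v j0) h4
          simp [ho] at h5
        · intro j _
          by_cases hj : j = j0
          · rw [hj, real_inner_comm, h]; simp
          · rw [hz j hj]; simp
      · exact h
    · intro j _ hj
      rw [real_inner_comm, hz j hj, zero_mul]
    · simp
  rw [aux_normsq hW, aux_normsq hW u, Finset.mul_sum]
  refine Finset.sum_le_sum fun j _ => ?_
  rw [aux_eig_inner]
  by_cases hj : j = j0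
  · rw [hj, h0]; simp
  · rw [mul_pow]
    gcongr ?_ * _
    rw [← sq_abs]
    have := hβ j hj
    gcongr

/-- Action of W on stacked vectors. -/
noncomputable def auxT {n p : ℕ} (W : Matrix (Fin n) (Fin n) ℝ) :
    PiLp 2 (fun _ : Fin n => EuclideanSpace ℝ (Fin p)) →ₗ[ℝ]
      PiLp 2 (fun _ : Fin n => EuclideanSpace ℝ (Fin p)) where
  toFun v := WithLp.toLp 2 (fun i => ∑ j, W i j • v j)
  map_add' u v := by
    ext i c
    simp [Finset.sum_add_distrib]
  map_smul' a v := by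
    ext i c
    simp [Finset.mul_sum]
    refine Finset.sum_congr rfl fun j _ => by ring

/-- coordinate slice -/
noncomputable def auxS {n p : ℕ} (v : PiLp 2 (fun _ : Fin n => EuclideanSpace ℝ (Fin p)))
    (c : Fin p) : EuclideanSpace ℝ (Fin n) := WithLp.toLp 2 (fun i => v i c)

lemma auxS_T {n p : ℕ} (W : Matrix (Fin n) (Fin n) ℝ)
    (v : PiLp 2 (fun _ : Fin n => EuclideanSpace ℝ (Fin p))) (c : Fin p) :
    auxS (auxT W v) c = Matrix.toEuclideanLin W (auxS v c) := by
  ext i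
  simp [auxS, auxT, Matrix.toLpLin_apply, Matrix.mulVec, dotProduct]

lemma auxS_inner {n p : ℕ} (u v : PiLp 2 (fun _ : Fin n => EuclideanSpace ℝ (Fin p))) :
    ⟪u, v⟫ = ∑ c, ⟪auxS u c, auxS v c⟫ := by
  simp only [PiLp.inner_apply, auxS]
  rw [Finset.sum_comm]

lemma auxS_norm {n p : ℕ} (v : PiLp 2 (fun _ : Fin n => EuclideanSpace ℝ (Fin p))) :
    ‖v‖ ^ 2 = ∑ c, ‖auxS v c‖ ^ 2 := by
  rw [← real_inner_self_eq_norm_sq, auxS_inner]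
  simp

lemma auxT_lower {n p : ℕ} {W : Matrix (Fin n) (Fin n) ℝ} (hW : W.IsHermitian) (l : ℝ)
    (hl : ∀ j, l ≤ hW.eigenvalues j) (v : PiLp 2 (fun _ : Fin n => EuclideanSpace ℝ (Fin p))) :
    l * ‖v‖ ^ 2 ≤ ⟪v, auxT W v⟫ := by
  rw [auxS_norm, auxS_inner, Finset.mul_sum]
  refine Finset.sum_le_sum fun c _ => ?_
  rw [auxS_T]
  exact aux_quad_lower hW l hl _

lemma auxT_upper {n p : ℕ} {W : Matrix (Fin n) (Fin n) ℝ} (hW : W.IsHermitian) (l : ℝ)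
    (hl : ∀ j, hW.eigenvalues j ≤ l) (v : PiLp 2 (fun _ : Fin n => EuclideanSpace ℝ (Fin p))) :
    ⟪v, auxT W v⟫ ≤ l * ‖v‖ ^ 2 := by
  rw [auxS_norm, auxS_inner, Finset.mul_sum]
  refine Finset.sum_le_sum fun c _ => ?_
  rw [auxS_T]
  exact aux_quad_upper hW l hl _

lemma auxT_symm {n p : ℕ} {W : Matrix (Fin n) (Fin n) ℝ} (hW : W.IsHermitian)
    (u v : PiLp 2 (fun _ : Fin n => EuclideanSpace ℝ (Fin p))) :
    ⟪auxT W u, v⟫ = ⟪u, auxT W v⟫ := by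
  rw [auxS_inner, auxS_inner]
  refine Finset.sum_congr rfl fun c _ => ?_
  rw [auxS_T, auxS_T]
  exact Matrix.isSymmetric_toEuclideanLin_iff.mpr hW _ _

lemma auxT_contract {n p : ℕ} {W : Matrix (Fin n) (Fin n) ℝ} (hW : W.IsHermitian)
    (hWrow : ∀ i, ∑ j, W i j = 1) (β : ℝ) (hβ0 : 0 ≤ β) (hβ1 : β < 1) (j0 : Fin n)
    (hβ : ∀ j, j ≠ j0 → |hW.eigenvalues j| ≤ β)
    (v : PiLp 2 (fun _ : Fin n => EuclideanSpace ℝ (Fin p))) (hv : ∑ i, v i = 0) :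
    ‖auxT W v‖ ≤ β * ‖v‖ := by
  refine abs_le_of_sq_le_sq' ?_ (by positivity) |>.2
  rw [mul_pow, auxS_norm, auxS_norm, Finset.mul_sum]
  refine Finset.sum_le_sum fun c _ => ?_
  rw [auxS_T]
  refine aux_contract hW hWrow β hβ1 j0 hβ _ ?_
  have := congrArg (fun w : EuclideanSpace ℝ (Fin p) => w c) hv
  simpa [auxS] using this

lemma aux_center {n p : ℕ} (hn : 0 < n) (v : PiLp 2 (fun _ : Fin n => EuclideanSpace ℝ (Fin p))) :
    ‖v - WithLp.toLp 2 (fun _ => (n : ℝ)⁻¹ • ∑ i, v i)‖ ≤ ‖v‖ := by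
  have hN : (0:ℝ) < n := by exact_mod_cast hn
  refine abs_le_of_sq_le_sq' ?_ (by positivity) |>.2
  rw [norm_sub_sq_real]
  have e1 : ⟪v, WithLp.toLp 2 (fun _ => (n : ℝ)⁻¹ • ∑ i, v i)⟫ = (n:ℝ)⁻¹ * ‖∑ i, v i‖ ^ 2 := by
    rw [PiLp.inner_apply, ← real_inner_self_eq_norm_sq, sum_inner, Finset.mul_sum]
    refine Finset.sum_congr rfl fun i _ => ?_
    rw [real_inner_smul_right]
  have e2 : ‖(WithLp.toLp 2 (fun _ => (n : ℝ)⁻¹ • ∑ i, v i) :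
      PiLp 2 (fun _ : Fin n => EuclideanSpace ℝ (Fin p)))‖ ^ 2
      = (n:ℝ) * (‖(n:ℝ)‖⁻¹ ^ 2 * ‖∑ i, v i‖ ^ 2) := by
    rw [PiLp.norm_sq_eq_of_L2]
    simp only [norm_smul, mul_pow,
      Finset.sum_const, Finset.card_univ, Fintype.card_fin, nsmul_eq_mul, norm_inv]
  rw [e1, e2]
  have : (n:ℝ) * (‖(n:ℝ)‖⁻¹ ^ 2 * ‖∑ i, v i‖ ^ 2) = (n:ℝ)⁻¹ * ‖∑ i, v i‖ ^ 2 := by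
    rw [Real.norm_of_nonneg hN.le]; field_simp
  rw [this]
  have : 0 ≤ (n:ℝ)⁻¹ * ‖∑ i, v i‖ ^ 2 := by positivity
  linarith

set_option maxHeartbeats 4000000 in
theorem mean_error_recurrence_strongly_convex
    {n p : ℕ} (hn : 0 < n)
    (f : Fin n → EuclideanSpace ℝ (Fin p) → ℝ)
    (gf : Fin n → EuclideanSpace ℝ (Fin p) → EuclideanSpace ℝ (Fin p))
    (Lf : Fin n → ℝ) (hLfpos : ∀ i, 0 < Lf i)
    (hconv : ∀ i, ConvexOn ℝ Set.univ (f i))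
    (hbdd : ∀ i, BddBelow (Set.range (f i)))
    (hgrad : ∀ i z, HasGradientAt (f i) (gf i z) z)
    (hlip : ∀ i, LipschitzWith (Lf i).toNNReal (gf i))
    (Lh : ℝ) (hLh : Lh = ⨆ i, Lf i)
    (W : Matrix (Fin n) (Fin n) ℝ)
    (hWsymm : W.IsHermitian)
    (hWnonneg : ∀ i j, 0 ≤ W i j)
    (hWrow : ∀ i, ∑ j, W i j = 1)
    (hWcol : ∀ j, ∑ i, W i j = 1)
    (lam : Fin n → ℝ) (hlamAnti : Antitone lam)
    (hlamEig : ∃ σ : Equiv.Perm (Fin n), lam = hWsymm.eigenvalues ∘ σ)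
    (hlam1 : lam ⟨0, hn⟩ = 1)
    (lamN : ℝ) (hlamN : lamN = lam ⟨n - 1, Nat.sub_lt hn Nat.one_pos⟩)
    (hlamNlb : -1 ≤ lamN)
    (β : ℝ) (hβdef : β = ⨆ j : {j : Fin n // j ≠ (⟨0, hn⟩ : Fin n)}, |lam j.1|)
    (α : ℝ) (hα : 0 < α)
    (x : ℕ → Fin n → EuclideanSpace ℝ (Fin p))
    (hiter : ∀ k i, x (k + 1) i = (∑ j, W i j • x k j) - α • gf i (x k i))
    (hx0 : ∀ i, x 0 i = 0)
    (D : ℝ) (hD : D = Real.sqrt (2 * Lh * ((∑ i, f i 0) - ∑ i, ⨅ z, f i z)))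
    (xbar : ℕ → EuclideanSpace ℝ (Fin p)) (hxbar : ∀ k, xbar k = (n : ℝ)⁻¹ • ∑ i, x k i)
    (Lfbar : ℝ) (hLfbar : Lfbar = (n : ℝ)⁻¹ * ∑ i, Lf i)
    (xstar : EuclideanSpace ℝ (Fin p)) (hxstar : ∀ z, ∑ i, f i xstar ≤ ∑ i, f i z)
    (μf : ℝ) (hμf : 0 < μf)
    (hsc : ∀ a b : EuclideanSpace ℝ (Fin p), μf * ‖a - b‖ ^ 2 ≤ ⟪(∑ i, gf i a) - (∑ i, gf i b), a - b⟫)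
    (μfbar : ℝ) (hμfbar : μfbar = μf / n)
    (c₁ : ℝ) (hc1 : c₁ = 1 / (μfbar + Lfbar))
    (c₂ : ℝ) (hc2 : c₂ = μfbar * Lfbar / (μfbar + Lfbar))
    (ebar : ℕ → EuclideanSpace ℝ (Fin p)) (hebar : ∀ k, ebar k = xbar k - xstar)
    (hstep : α ≤ min ((1 + lamN) / Lh) c₁)
    (hβlt : β < 1)
 :
    ∀ δ : ℝ, 0 < δ → ∀ k,
      ‖ebar (k + 1)‖ ^ 2
        ≤ (1 - α * c₂ + α * δ - α ^ 2 * δ * c₂) * ‖ebar k‖ ^ 2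
          + α ^ 3 * (α + δ⁻¹) * Lh ^ 2 * D ^ 2 / (1 - β) ^ 2 := by
  have hN : (0:ℝ) < n := by exact_mod_cast hn
  have : Nonempty (Fin n) := ⟨⟨0, hn⟩⟩
  have hL : ∀ i a b, ‖gf i a - gf i b‖ ≤ Lf i * ‖a - b‖ := by
    intro i a b
    have := (hlip i).norm_sub_le a b
    rwa [Real.coe_toNNReal _ (hLfpos i).le] at this
  have hLle : ∀ i, Lf i ≤ Lh := fun i => hLh ▸ le_ciSup (Set.finite_range Lf).bddAbove i
  have hLhpos : 0 < Lh := (hLfpos ⟨0, hn⟩).trans_le (hLle _)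
  -- eigenvalue facts
  obtain ⟨σ, hσ⟩ := hlamEig
  have heig : ∀ j, hWsymm.eigenvalues j = lam (σ.symm j) := by
    intro j; rw [hσ]; simp
  have hlow : ∀ j, lamN ≤ hWsymm.eigenvalues j := by
    intro j
    rw [heig, hlamN]
    apply hlamAnti
    rw [Fin.le_def]
    have := (σ.symm j).2
    simp only
    omega
  have hup : ∀ j, hWsymm.eigenvalues j ≤ 1 := by
    intro j
    rw [heig, ← hlam1]
    apply hlamAnti
    rw [Fin.le_def]
    simp
  have hβ0 : 0 ≤ β := hβdef ▸ Real.iSup_nonneg fun j => abs_nonneg _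
  have hβj : ∀ j, j ≠ σ ⟨0, hn⟩ → |hWsymm.eigenvalues j| ≤ β := by
    intro j hj
    rw [heig, hβdef]
    have hj' : σ.symm j ≠ ⟨0, hn⟩ := fun h => hj (by rw [← h]; simp)
    exact le_ciSup (f := fun j : {j : Fin n // j ≠ (⟨0, hn⟩ : Fin n)} => |lam j.1|)
      (Set.finite_range _).bddAbove ⟨σ.symm j, hj'⟩
  have hα1 : α * Lh ≤ 1 + lamN := by
    have := hstep.trans (min_le_left _ _)
    rwa [le_div_iff₀ hLhpos] at this
  have hα2 : α ≤ c₁ := hstep.trans (min_le_right _ _)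
  -- stacks
  set X : ℕ → PiLp 2 (fun _ : Fin n => EuclideanSpace ℝ (Fin p)) :=
    fun k => WithLp.toLp 2 (x k) with hXdef
  set G : ℕ → PiLp 2 (fun _ : Fin n => EuclideanSpace ℝ (Fin p)) :=
    fun k => WithLp.toLp 2 (fun i => gf i (x k i)) with hGdef
  have hX : ∀ k, X (k + 1) = auxT W (X k) - α • G k := by
    intro k
    apply PiLp.ext
    intro i
    simp [hXdef, hGdef, auxT, hiter]
  -- monotone Lyapunov function
  have hmono : ∀ k, α * ∑ i, f i (x k i) + (‖X k‖ ^ 2 - ⟪X k, auxT W (X k)⟫) / 2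
      ≤ α * ∑ i, f i 0 := by
    intro k
    induction k with
    | zero =>
      have : X 0 = 0 := by
        apply PiLp.ext
        intro i
        simp [hXdef, hx0]
      rw [this]
      simp [hx0]
    | succ k ih =>
      refine le_trans ?_ ih
      set d := X (k + 1) - X k with hd
      have hXd : X (k + 1) = X k + d := by rw [hd]; abel
      have hG : α • G k = auxT W (X k) - X k - d := by
        rw [hd, hX]; abel
      have h1 : ∑ i, f i (x (k + 1) i) ≤ ∑ i, f i (x k i) + ⟪G k, d⟫ + Lh / 2 * ‖d‖ ^ 2 := by
        rw [PiLp.inner_apply, PiLp.norm_sq_eq_of_L2, Finset.mul_sum, ← Finset.sum_add_distrib,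
          ← Finset.sum_add_distrib]
        refine Finset.sum_le_sum fun i _ => ?_
        have h2 := aux_descent (hgrad i) (hL i) (x k i) (d i)
        have h3 : x k i + d i = x (k + 1) i := by simp [hd, hXdef]
        rw [h3] at h2
        refine h2.trans ?_
        have := hLle i
        simp only [hGdef]
        gcongr
      have h2 : α * ⟪G k, d⟫ = ⟪auxT W (X k), d⟫ - ⟪X k, d⟫ - ‖d‖ ^ 2 := by
        rw [← real_inner_self_eq_norm_sq, ← inner_sub_left, ← inner_sub_left, ← hG,
          real_inner_smul_left]
      have h3 : ‖X (k + 1)‖ ^ 2 = ‖X k‖ ^ 2 + 2 * ⟪X k, d⟫ + ‖d‖ ^ 2 := by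
        rw [hXd, norm_add_sq_real]
      have h4 : ⟪X (k + 1), auxT W (X (k + 1))⟫ = ⟪X k, auxT W (X k)⟫
          + 2 * ⟪auxT W (X k), d⟫ + ⟪d, auxT W d⟫ := by
        rw [hXd, map_add, inner_add_left, inner_add_right, inner_add_right,
          ← auxT_symm hWsymm (X k) d, real_inner_comm d (auxT W (X k))]
        ring
      have h5 := auxT_lower hWsymm lamN hlow d
      have h6 : α * ∑ i, f i (x (k + 1) i)
          ≤ α * (∑ i, f i (x k i) + ⟪G k, d⟫ + Lh / 2 * ‖d‖ ^ 2) := by gcongr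
      have h7 : (α * Lh) * ‖d‖ ^ 2 ≤ (1 + lamN) * ‖d‖ ^ 2 := by gcongr
      rw [h3, h4]
      nlinarith
  have hD0 : 0 ≤ D := hD ▸ Real.sqrt_nonneg _
  have hGD : ∀ k, ‖G k‖ ≤ D := by
    intro k
    rw [hD]
    apply Real.le_sqrt_of_sq_le
    have h1 : ∑ i, f i (x k i) ≤ ∑ i, f i 0 := by
      have h2 := auxT_upper hWsymm 1 hup (X k)
      have h3 := hmono k
      have h4 : α * ∑ i, f i (x k i) ≤ α * ∑ i, f i 0 := by linarith
      exact le_of_mul_le_mul_left h4 hα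
    refine le_trans ?_ (mul_le_mul_of_nonneg_left (sub_le_sub_right h1 _) (by positivity))
    rw [PiLp.norm_sq_eq_of_L2, ← Finset.sum_sub_distrib, Finset.mul_sum]
    refine Finset.sum_le_sum fun i _ => ?_
    have hinf : ∀ z, ⨅ z, f i z ≤ f i z := fun z => ciInf_le (hbdd i) z
    refine (aux_grad_sq (hgrad i) (hLfpos i) (hL i) _ hinf (x k i)).trans ?_
    have h2 : 0 ≤ f i (x k i) - ⨅ z, f i z := sub_nonneg.mpr (hinf _)
    have := hLle i
    gcongr
  -- consensus error
  set C : ℕ → PiLp 2 (fun _ : Fin n => EuclideanSpace ℝ (Fin p)) :=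
    fun k => X k - WithLp.toLp 2 (fun _ => xbar k) with hCdef
  have hxbs : ∀ k, xbar (k + 1) = xbar k - α • ((n:ℝ)⁻¹ • ∑ i, gf i (x k i)) := by
    intro k
    rw [hxbar, hxbar]
    simp only [hiter, Finset.sum_sub_distrib]
    rw [Finset.sum_comm]
    simp only [← Finset.sum_smul, hWcol, one_smul, ← Finset.smul_sum]
    rw [smul_sub, smul_comm]
  have hCsum : ∀ k, ∑ i, C k i = 0 := by
    intro k
    simp only [hCdef, hXdef, PiLp.sub_apply, Finset.sum_sub_distrib, Finset.sum_const,
      Finset.card_univ, Fintype.card_fin]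
    rw [hxbar, ← Nat.cast_smul_eq_nsmul ℝ, smul_smul, mul_inv_cancel₀ hN.ne', one_smul, sub_self]
  have hCs : ∀ k, C (k + 1) = auxT W (C k)
      - α • (G k - WithLp.toLp 2 (fun _ => (n:ℝ)⁻¹ • ∑ i, G k i)) := by
    intro k
    have h1 : auxT W (WithLp.toLp 2 (fun _ : Fin n => xbar k))
        = WithLp.toLp 2 (fun _ : Fin n => xbar k) := by
      apply PiLp.ext
      intro i
      simp [auxT, ← Finset.sum_smul, hWrow]
    simp only [hCdef]
    rw [map_sub, h1, hX]
    apply PiLp.ext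
    intro i
    simp only [PiLp.sub_apply, PiLp.smul_apply, hxbs, hGdef, smul_sub]
    abel
  have hC : ∀ k, ‖C k‖ ≤ α * D / (1 - β) := by
    have hb : 0 < 1 - β := by linarith
    intro k
    induction k with
    | zero =>
      have : C 0 = 0 := by
        apply PiLp.ext
        intro i
        simp [hCdef, hXdef, hx0, hxbar]
      rw [this, norm_zero]
      positivity
    | succ k ih =>
      rw [hCs]
      have h1 := auxT_contract hWsymm hWrow β hβ0 hβlt _ hβj (C k) (hCsum k)
      have h2 := (aux_center hn (G k)).trans (hGD k)
      calc _ ≤ ‖auxT W (C k)‖ + ‖α • (G k - WithLp.toLp 2 (fun _ => (n:ℝ)⁻¹ • ∑ i, G k i))‖ :=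
            norm_sub_le _ _
        _ ≤ β * (α * D / (1 - β)) + α * D := by
            rw [norm_smul, Real.norm_of_nonneg hα.le]
            gcongr
            exact h1.trans (by gcongr)
        _ = α * D / (1 - β) := by field_simp; ring
  intro δ hδ k
  set gb : EuclideanSpace ℝ (Fin p) := (n:ℝ)⁻¹ • ∑ i, gf i (xbar k) with hgb
  set r : EuclideanSpace ℝ (Fin p) :=
    (n:ℝ)⁻¹ • ∑ i, gf i (xbar k) - (n:ℝ)⁻¹ • ∑ i, gf i (x k i) with hr
  have hrb : ‖r‖ ≤ Lh * (α * D / (1 - β)) := by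
    have hCi : ∀ i, ‖C k i‖ ≤ α * D / (1 - β) := fun i =>
      (PiLp.norm_apply_le (C k) i).trans (hC k)
    rw [hr, ← smul_sub, ← Finset.sum_sub_distrib, norm_smul, norm_inv,
      Real.norm_of_nonneg hN.le, inv_mul_le_iff₀ hN]
    refine (norm_sum_le _ _).trans ?_
    have : ∀ i ∈ Finset.univ, ‖gf i (xbar k) - gf i (x k i)‖ ≤ Lh * (α * D / (1 - β)) := by
      intro i _
      refine (hL i _ _).trans ?_
      have h1 := hCi i
      have h2 : C k i = x k i - xbar k := by simp [hCdef, hXdef]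
      rw [h2, norm_sub_rev] at h1
      exact mul_le_mul (hLle i) h1 (norm_nonneg _) hLhpos.le
    refine (Finset.sum_le_card_nsmul _ _ _ this).trans ?_
    simp
  -- properties of the sum function
  have hFg : ∀ z, HasGradientAt (fun z => ∑ i, f i z) (∑ i, gf i z) z := by
    intro z
    rw [hasGradientAt_iff_hasFDerivAt, map_sum]
    exact HasFDerivAt.fun_sum fun i _ => (hgrad i z).hasFDerivAt
  have hFc : ConvexOn ℝ Set.univ (fun z => ∑ i, f i z) := by
    refine ⟨convex_univ, fun a ha b hb s t hs ht hst => ?_⟩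
    simp only [smul_eq_mul, Finset.mul_sum, ← Finset.sum_add_distrib]
    exact Finset.sum_le_sum fun i _ => (hconv i).2 ha hb hs ht hst
  have hFL : ∀ a b, ‖∑ i, gf i a - ∑ i, gf i b‖ ≤ (∑ i, Lf i) * ‖a - b‖ := by
    intro a b
    rw [← Finset.sum_sub_distrib, Finset.sum_mul]
    exact (norm_sum_le _ _).trans (Finset.sum_le_sum fun i _ => hL i a b)
  have hLs : 0 < ∑ i, Lf i := Finset.sum_pos (fun i _ => hLfpos i) Finset.univ_nonempty
  have hgs : ∑ i, gf i xstar = 0 := by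
    have h1 : IsLocalMin (fun z => ∑ i, f i z) xstar := Filter.Eventually.of_forall hxstar
    have h2 := h1.hasFDerivAt_eq_zero (hFg xstar).hasFDerivAt
    exact (InnerProductSpace.toDual ℝ (EuclideanSpace ℝ (Fin p))).map_eq_zero_iff.mp h2
  have hco := aux_cocoercive hFg hLs hFL hFc xstar (xbar k) hgs
  have hst := hsc (xbar k) xstar
  rw [hgs, sub_zero, ← hebar] at hst
  rw [← hebar] at hco
  have hsum : ∑ i, gf i (xbar k) = (n:ℝ) • gb := by
    rw [hgb, smul_smul, mul_inv_cancel₀ hN.ne', one_smul]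
  have hsumL : ∑ i, Lf i = n * Lfbar := by rw [hLfbar]; field_simp
  have hmu : μf = n * μfbar := by rw [hμfbar]; field_simp
  have hLb : 0 < Lfbar := by rw [hLfbar]; positivity
  have hmb : 0 < μfbar := by rw [hμfbar]; positivity
  rw [hsum, hsumL, real_inner_smul_left, norm_smul, Real.norm_of_nonneg hN.le] at hco
  rw [hsum, hmu, real_inner_smul_left] at hst
  have hco' : ‖gb‖ ^ 2 ≤ Lfbar * ⟪gb, ebar k⟫ := by
    have : (n:ℝ) ^ 2 * ‖gb‖ ^ 2 ≤ (n:ℝ) ^ 2 * (Lfbar * ⟪gb, ebar k⟫) := by linarith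
    exact le_of_mul_le_mul_left this (by positivity)
  have hst' : μfbar * ‖ebar k‖ ^ 2 ≤ ⟪gb, ebar k⟫ := by
    have : (n:ℝ) * (μfbar * ‖ebar k‖ ^ 2) ≤ n * ⟪gb, ebar k⟫ := by linarith
    exact le_of_mul_le_mul_left this hN
  have hin : 0 ≤ ⟪gb, ebar k⟫ := le_trans (by positivity) hst'
  have hαL : α * Lfbar ≤ 1 := by
    rw [hc1, le_div_iff₀ (by positivity)] at hα2
    nlinarith
  have hc2le : c₂ ≤ μfbar := by
    rw [hc2, div_le_iff₀ (by positivity)]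
    nlinarith
  have hone : ‖ebar k - α • gb‖ ^ 2 ≤ (1 - α * c₂) * ‖ebar k‖ ^ 2 := by
    rw [norm_sub_sq_real, inner_smul_right, norm_smul, Real.norm_of_nonneg hα.le,
      real_inner_comm]
    have h1 : α * ‖gb‖ ^ 2 ≤ ⟪gb, ebar k⟫ :=
      calc α * ‖gb‖ ^ 2 ≤ α * (Lfbar * ⟪gb, ebar k⟫) := by gcongr
        _ = (α * Lfbar) * ⟪gb, ebar k⟫ := by ring
        _ ≤ 1 * ⟪gb, ebar k⟫ := by gcongr
        _ = _ := one_mul _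
    have h2 : c₂ * ‖ebar k‖ ^ 2 ≤ ⟪gb, ebar k⟫ := le_trans (by gcongr) hst'
    have h3 := mul_le_mul_of_nonneg_left h1 hα.le
    have h4 := mul_le_mul_of_nonneg_left h2 hα.le
    nlinarith
  have hes : ebar (k + 1) = (ebar k - α • gb) + α • r := by
    rw [hebar, hebar, hxbs, hr, hgb, smul_sub]
    abel
  have hyoung : ‖ebar (k + 1)‖ ^ 2
      ≤ (1 + α * δ) * ‖ebar k - α • gb‖ ^ 2 + α * (α + δ⁻¹) * ‖r‖ ^ 2 := by
    rw [hes, norm_add_sq_real, inner_smul_right, norm_smul, Real.norm_of_nonneg hα.le]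
    have h1 := real_inner_le_norm (ebar k - α • gb) r
    have h2 : 2 * (‖ebar k - α • gb‖ * ‖r‖) ≤ δ * ‖ebar k - α • gb‖ ^ 2 + δ⁻¹ * ‖r‖ ^ 2 := by
      have h3 : 0 ≤ δ⁻¹ * (δ * ‖ebar k - α • gb‖ - ‖r‖) ^ 2 := by positivity
      have h4 : δ⁻¹ * (δ * ‖ebar k - α • gb‖ - ‖r‖) ^ 2 = δ * ‖ebar k - α • gb‖ ^ 2
        + δ⁻¹ * ‖r‖ ^ 2 - 2 * (‖ebar k - α • gb‖ * ‖r‖) := by field_simp; ring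
      linarith
    have h5 := mul_le_mul_of_nonneg_left (h2.trans' (mul_le_mul_of_nonneg_left h1 zero_le_two))
      hα.le
    nlinarith
  calc _ ≤ _ := hyoung
    _ ≤ (1 + α * δ) * ((1 - α * c₂) * ‖ebar k‖ ^ 2)
        + α * (α + δ⁻¹) * (Lh * (α * D / (1 - β))) ^ 2 := by gcongr
    _ = _ := by
        generalize 1 - β = b
        ring
end

section
/- (Theorem 3, geometric convergence to a neighborhood) Suppose f := Σ_{i=1}^n f_i is strongly convex with modulus μ_f > 0. Set μ_f̄ := μ_f/n, c₁ := 1/(μ_f̄ + L_f̄), c₂ := μ_f̄ L_f̄/(μ_f̄ + L_f̄), and c₃ := √(1 − α c₂/2). If α ≤ min{(1 + λ_n(W))/L_h, c₁} and β < 1, then c₃ ∈ (0,1) and for all k ≥ 0: ‖ē(k)‖ ≤ c₃^k ‖ē(0)‖ + (α L_h D/(1 − β)) · √(4/c₂² − 2α/c₂). -/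
open scoped RealInnerProductSpace

section aux
variable {E : Type*} [NormedAddCommGroup E] [InnerProductSpace ℝ E] 

lemma dgd_line [CompleteSpace E] (f : E → ℝ) (g : E → E) (hg : ∀ z, HasGradientAt f (g z) z) (x d : E) (t : ℝ) :
    HasDerivAt (fun t : ℝ => f (x + t • d)) ⟪g (x + t • d), d⟫ t := by
  have h1 : HasDerivAt (fun t : ℝ => x + t • d) d t := by
    simpa using ((hasDerivAt_id t).smul_const d).const_add x
  have h2 := (hg (x + t • d)).hasFDerivAt.comp_hasDerivAt t h1
  have h3 : (InnerProductSpace.toDual ℝ E (g (x + t • d))) d = ⟪g (x + t • d), d⟫ := by simp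
  rw [h3] at h2
  exact h2

lemma dgd_descent [CompleteSpace E] (f : E → ℝ) (g : E → E) (L : ℝ) (hg : ∀ z, HasGradientAt f (g z) z)
    (hl : ∀ a b, ‖g a - g b‖ ≤ L * ‖a - b‖) (x y : E) :
    f y ≤ f x + ⟪g x, y - x⟫ + L / 2 * ‖y - x‖ ^ 2 := by
  set d := y - x with hd
  let φ : ℝ → ℝ := fun t => f (x + t • d) - t * ⟪g x, d⟫ - L / 2 * ‖d‖ ^ 2 * t ^ 2
  have hφ : ∀ t, HasDerivAt φ (⟪g (x + t • d), d⟫ - ⟪g x, d⟫ - L * ‖d‖ ^ 2 * t) t := by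
    intro t
    have h1 := dgd_line f g hg x d t
    have h2 : HasDerivAt (fun t : ℝ => t * ⟪g x, d⟫) ⟪g x, d⟫ t := by
      simpa using (hasDerivAt_id t).mul_const ⟪g x, d⟫
    have h3 : HasDerivAt (fun t : ℝ => L / 2 * ‖d‖ ^ 2 * t ^ 2) (L * ‖d‖ ^ 2 * t) t := by
      have := ((hasDerivAt_pow 2 t)).const_mul (L / 2 * ‖d‖ ^ 2)
      have e : L / 2 * ‖d‖ ^ 2 * (((2 : ℕ) : ℝ) * t ^ (2 - 1)) = L * ‖d‖ ^ 2 * t := by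
        norm_num; ring
      rw [e] at this
      exact this
    exact (h1.sub h2).sub h3
  have hanti : AntitoneOn φ (Set.Ici 0) := by
    apply antitoneOn_of_deriv_nonpos (convex_Ici 0)
    · exact fun t _ => (hφ t).continuousAt.continuousWithinAt
    · exact fun t _ => (hφ t).differentiableAt.differentiableWithinAt
    · intro t ht
      rw [interior_Ici, Set.mem_Ioi] at ht
      rw [(hφ t).deriv, ← inner_sub_left]
      have h1 := real_inner_le_norm (g (x + t • d) - g x) d
      have h2 := hl (x + t • d) x
      rw [add_sub_cancel_left, norm_smul, Real.norm_of_nonneg ht.le] at h2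
      have h3 := mul_le_mul_of_nonneg_right h2 (norm_nonneg d)
      nlinarith
  have := hanti (Set.mem_Ici.2 le_rfl) (Set.mem_Ici.2 zero_le_one) zero_le_one
  simp only [φ, one_smul, zero_smul, hd] at this
  rw [add_sub_cancel, ← hd] at this
  simp at this
  linarith

lemma dgd_first [CompleteSpace E] (f : E → ℝ) (g : E → E) (hg : ∀ z, HasGradientAt f (g z) z)
    (hc : ConvexOn ℝ Set.univ f) (x y : E) :
    f x + ⟪g x, y - x⟫ ≤ f y := by
  have h1 := dgd_line f g hg x (y - x) 0
  have hc' : ConvexOn ℝ Set.univ (fun t : ℝ => f (x + t • (y - x))) := by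
    have := hc.comp_affineMap (AffineMap.lineMap x y)
    have e : (f ∘ ⇑(AffineMap.lineMap (k := ℝ) x y)) = (fun t : ℝ => f (x + t • (y - x))) := by
      funext t
      simp [AffineMap.lineMap_apply, add_comm]
    rw [e, Set.preimage_univ] at this
    exact this
  have := hc'.le_slope_of_hasDerivAt (Set.mem_univ 0) (Set.mem_univ 1) zero_lt_one h1
  simp [slope_def_field] at this
  linarith

lemma dgd_gradbd (f : E → ℝ) (g : E → E) (L : ℝ) (hL : 0 < L)
    (hd : ∀ x y, f y ≤ f x + ⟪g x, y - x⟫ + L / 2 * ‖y - x‖ ^ 2) (m : ℝ) (hm : ∀ z, m ≤ f z) (x : E) :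
    ‖g x‖ ^ 2 ≤ 2 * L * (f x - m) := by
  have h1 := hd x (x - L⁻¹ • g x)
  have h2 := hm (x - L⁻¹ • g x)
  rw [sub_sub_cancel_left, inner_neg_right, real_inner_smul_right, real_inner_self_eq_norm_sq,
    norm_neg, norm_smul, Real.norm_of_nonneg (inv_pos.2 hL).le, mul_pow] at h1
  have h3 : L / 2 * (L⁻¹ ^ 2 * ‖g x‖ ^ 2) = L⁻¹ * ‖g x‖ ^ 2 / 2 := by field_simp
  have h4 : ‖g x‖ ^ 2 = L * (L⁻¹ * ‖g x‖ ^ 2) := by field_simp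
  rw [h4]
  nlinarith

lemma dgd_coco (f : E → ℝ) (g : E → E) (L : ℝ) (hL : 0 < L)
    (hd : ∀ x y, f y ≤ f x + ⟪g x, y - x⟫ + L / 2 * ‖y - x‖ ^ 2)
    (hc : ∀ x y, f x + ⟪g x, y - x⟫ ≤ f y) (x y : E) :
    ‖g x - g y‖ ^ 2 ≤ L * ⟪g x - g y, x - y⟫ := by
  have key : ∀ a b : E, ‖g b - g a‖ ^ 2 ≤ 2 * L * (f b - f a - ⟪g a, b - a⟫) := by
    intro a b
    have := dgd_gradbd (fun z => f z - ⟪g a, z⟫) (fun z => g z - g a) L hL ?_ (f a - ⟪g a, a⟫) ?_ b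
    · refine this.trans (le_of_eq ?_)
      simp only [inner_sub_right]; ring
    · intro u v
      have := hd u v
      simp only [inner_sub_right, inner_sub_left] at this ⊢
      linarith
    · intro z
      have := hc a z
      simp only [inner_sub_right] at this ⊢
      linarith
  have h1 := key x y
  have h2 := key y x
  rw [norm_sub_rev] at h1
  simp only [inner_sub_right, inner_sub_left] at *
  nlinarith
end aux

section spec
variable {n : ℕ} (W : Matrix (Fin n) (Fin n) ℝ) (hW : W.IsHermitian)

lemma dgd_eig (v : EuclideanSpace ℝ (Fin n)) (j : Fin n) :
    ⟪hW.eigenvectorBasis j, (WithLp.toLp 2 (W.mulVec v.ofLp) : EuclideanSpace ℝ (Fin n))⟫ =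
      hW.eigenvalues j * ⟪hW.eigenvectorBasis j, v⟫ := by
  have h := hW.mulVec_eigenvectorBasis j
  have hT : W.transpose = W := by simpa [Matrix.conjTranspose_eq_transpose_of_trivial] using hW.eq
  rw [EuclideanSpace.inner_eq_star_dotProduct, EuclideanSpace.inner_eq_star_dotProduct]
  simp only [star_trivial]
  rw [dotProduct_comm, Matrix.dotProduct_mulVec, ← Matrix.mulVec_transpose, hT, h, smul_dotProduct, dotProduct_comm, smul_eq_mul]

lemma dgd_quad (v : Fin n → ℝ) :
    ∑ i, v i * ∑ j, W i j * v j = ∑ j, hW.eigenvalues j * ⟪hW.eigenvectorBasis j, WithLp.toLp 2 v⟫ ^ 2 := by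
  have h := hW.eigenvectorBasis.sum_inner_mul_inner (WithLp.toLp 2 v) (WithLp.toLp 2 (W.mulVec v))
  have h2 : ⟪(WithLp.toLp 2 v : EuclideanSpace ℝ (Fin n)), WithLp.toLp 2 (W.mulVec v)⟫ = ∑ i, v i * ∑ j, W i j * v j := by
    simp [PiLp.inner_apply, Matrix.mulVec, dotProduct, mul_comm]
  rw [← h2, ← h]
  refine Finset.sum_congr rfl fun j _ => ?_
  have := dgd_eig W hW (WithLp.toLp 2 v) j
  rw [this, real_inner_comm]
  ring

lemma dgd_sq (v : Fin n → ℝ) :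
    ∑ i, (∑ j, W i j * v j) ^ 2 = ∑ j, hW.eigenvalues j ^ 2 * ⟪hW.eigenvectorBasis j, WithLp.toLp 2 v⟫ ^ 2 := by
  have h := hW.eigenvectorBasis.sum_sq_inner_right (WithLp.toLp 2 (W.mulVec v))
  rw [EuclideanSpace.real_norm_sq_eq] at h
  simp only [Matrix.mulVec, dotProduct] at h
  rw [← h]
  refine Finset.sum_congr rfl fun j _ => ?_
  have := dgd_eig W hW (WithLp.toLp 2 v) j
  simp only [Matrix.mulVec, dotProduct] at this
  rw [this]
  ring

lemma dgd_pars (v : Fin n → ℝ) :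
    ∑ i, v i ^ 2 = ∑ j, ⟪hW.eigenvectorBasis j, WithLp.toLp 2 v⟫ ^ 2 := by
  rw [hW.eigenvectorBasis.sum_sq_inner_right, EuclideanSpace.real_norm_sq_eq]

lemma dgd_low (l : ℝ) (hl : ∀ j, l ≤ hW.eigenvalues j) (v : Fin n → ℝ) :
    l * ∑ i, v i ^ 2 ≤ ∑ i, v i * ∑ j, W i j * v j := by
  rw [dgd_quad W hW, dgd_pars W hW, Finset.mul_sum]
  exact Finset.sum_le_sum fun j _ => mul_le_mul_of_nonneg_right (hl j) (sq_nonneg _)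

lemma dgd_up (hl : ∀ j, hW.eigenvalues j ≤ 1) (v : Fin n → ℝ) :
    ∑ i, v i * ∑ j, W i j * v j ≤ ∑ i, v i ^ 2  := by
  rw [dgd_quad W hW, dgd_pars W hW]
  exact Finset.sum_le_sum fun j _ => by nlinarith [hl j, sq_nonneg ⟪hW.eigenvectorBasis j, WithLp.toLp 2 v⟫]

lemma dgd_contr (hWrow : ∀ i, ∑ j, W i j = 1) (hn : 0 < n) (j0 : Fin n) (β : ℝ) (hβ : β < 1)
    (hl : ∀ j, j ≠ j0 → |hW.eigenvalues j| ≤ β) (v : Fin n → ℝ) (hv : ∑ i, v i = 0) :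
    ∑ i, (∑ j, W i j * v j) ^ 2 ≤ β ^ 2 * ∑ i, v i ^ 2 := by
  let one : EuclideanSpace ℝ (Fin n) := WithLp.toLp 2 (fun _ => 1)
  have h1 : ∀ j, j ≠ j0 → ⟪hW.eigenvectorBasis j, one⟫ = 0 := by
    intro j hj
    have := dgd_eig W hW one j
    have h2 : W.mulVec one.ofLp = one.ofLp := by
      ext i; simp [one, Matrix.mulVec, dotProduct, hWrow]
    rw [h2] at this
    have h3 : hW.eigenvalues j < 1 := (le_abs_self _).trans_lt ((hl j hj).trans_lt hβ)
    have h4 : (1 - hW.eigenvalues j) * ⟪hW.eigenvectorBasis j, one⟫ = 0 := by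
      simp only [WithLp.toLp_ofLp] at this
      linarith
    rcases mul_eq_zero.1 h4 with h | h
    · linarith
    · exact h
  have hone : ⟪one, (WithLp.toLp 2 v : EuclideanSpace ℝ (Fin n))⟫ = 0 := by
    simp [one, PiLp.inner_apply, hv]
  have hnn : (∑ j, ⟪hW.eigenvectorBasis j, one⟫ ^ 2) = n := by
    rw [hW.eigenvectorBasis.sum_sq_inner_right, EuclideanSpace.real_norm_sq_eq]; simp [one]
  rw [Finset.sum_eq_single j0 (fun j _ hj => by rw [h1 j hj]; simp) (by simp)] at hnn
  have hne : ⟪hW.eigenvectorBasis j0, one⟫ ≠ 0 := by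
    intro h; rw [h] at hnn; 
    have : (0:ℝ) < n := by exact_mod_cast hn
    simp at hnn; linarith
  rw [← hW.eigenvectorBasis.sum_inner_mul_inner, Finset.sum_eq_single j0 (fun j _ hj => by rw [real_inner_comm, h1 j hj]; simp) (by simp), real_inner_comm] at hone
  have h0 := (mul_eq_zero.1 hone).resolve_left hne
  rw [dgd_sq W hW, dgd_pars W hW, Finset.mul_sum]
  refine Finset.sum_le_sum fun j _ => ?_
  by_cases hj : j = j0
  · subst hj; rw [h0]; simp
  · refine mul_le_mul_of_nonneg_right ?_ (sq_nonneg _)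
    rw [← sq_abs]
    exact pow_le_pow_left₀ (abs_nonneg _) (hl j hj) 2
end spec

section vec
variable {n p : ℕ} (W : Matrix (Fin n) (Fin n) ℝ) (hW : W.IsHermitian)

lemma dgd_vsq (y : Fin n → EuclideanSpace ℝ (Fin p)) :
    ∑ i, ‖y i‖ ^ 2 = ∑ c, ∑ i, (y i c) ^ 2 := by
  rw [Finset.sum_comm]
  exact Finset.sum_congr rfl fun i _ => by rw [EuclideanSpace.real_norm_sq_eq]

lemma dgd_vapp (y : Fin n → EuclideanSpace ℝ (Fin p)) (i : Fin n) (c : Fin p) :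
    (∑ j, W i j • y j) c = ∑ j, W i j * y j c := by
  simp

lemma dgd_vquad (y : Fin n → EuclideanSpace ℝ (Fin p)) :
    ∑ i, ⟪y i, ∑ j, W i j • y j⟫ = ∑ c, ∑ i, y i c * ∑ j, W i j * y j c := by
  rw [Finset.sum_comm]
  refine Finset.sum_congr rfl fun i _ => ?_
  rw [PiLp.inner_apply]
  refine Finset.sum_congr rfl fun c _ => ?_
  rw [dgd_vapp]
  simp [mul_comm]

lemma dgd_vlow (l : ℝ) (hl : ∀ j, l ≤ hW.eigenvalues j) (y : Fin n → EuclideanSpace ℝ (Fin p)) :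
    l * ∑ i, ‖y i‖ ^ 2 ≤ ∑ i, ⟪y i, ∑ j, W i j • y j⟫ := by
  rw [dgd_vsq, dgd_vquad, Finset.mul_sum]
  exact Finset.sum_le_sum fun c _ => dgd_low W hW l hl fun i => y i c

lemma dgd_vup (hl : ∀ j, hW.eigenvalues j ≤ 1) (y : Fin n → EuclideanSpace ℝ (Fin p)) :
    ∑ i, ⟪y i, ∑ j, W i j • y j⟫ ≤ ∑ i, ‖y i‖ ^ 2 := by
  rw [dgd_vsq, dgd_vquad]
  exact Finset.sum_le_sum fun c _ => dgd_up W hW hl fun i => y i c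

lemma dgd_vcontr (hWrow : ∀ i, ∑ j, W i j = 1) (hn : 0 < n) (j0 : Fin n) (β : ℝ) (hβ : β < 1)
    (hl : ∀ j, j ≠ j0 → |hW.eigenvalues j| ≤ β) (y : Fin n → EuclideanSpace ℝ (Fin p))
    (hy : ∑ i, y i = 0) :
    ∑ i, ‖∑ j, W i j • y j‖ ^ 2 ≤ β ^ 2 * ∑ i, ‖y i‖ ^ 2 := by
  rw [dgd_vsq, dgd_vsq, Finset.mul_sum]
  refine Finset.sum_le_sum fun c _ => ?_
  have := dgd_contr W hW hWrow hn j0 β hβ hl (fun i => y i c) (by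
    have := congrArg (fun z : EuclideanSpace ℝ (Fin p) => z c) hy
    simpa using this)
  simpa only [dgd_vapp] using this

lemma dgd_symm (hW : W.IsHermitian) (u v : Fin n → EuclideanSpace ℝ (Fin p)) :
    ∑ i, ⟪u i, ∑ j, W i j • v j⟫ = ∑ i, ⟪v i, ∑ j, W i j • u j⟫ := by
  simp only [inner_sum, real_inner_smul_right]
  rw [Finset.sum_comm]
  refine Finset.sum_congr rfl fun i _ => Finset.sum_congr rfl fun j _ => ?_
  have h := hW.apply i j
  simp only [star_trivial] at h
  rw [h, real_inner_comm]

/-- one step of the Lyapunov decrease -/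
lemma dgd_lyap (l : ℝ) (hl : ∀ j, l ≤ hW.eigenvalues j)
    (f : Fin n → EuclideanSpace ℝ (Fin p) → ℝ)
    (g : Fin n → EuclideanSpace ℝ (Fin p) → EuclideanSpace ℝ (Fin p)) (L α : ℝ) (hα : 0 < α)
    (hd : ∀ i x y, f i y ≤ f i x + ⟪g i x, y - x⟫ + L / 2 * ‖y - x‖ ^ 2)
    (hs : α * L ≤ 1 + l) (u v : Fin n → EuclideanSpace ℝ (Fin p))
    (hv : ∀ i, v i = (∑ j, W i j • u j) - α • g i (u i)) :
    1 / 2 * (∑ i, ‖v i‖ ^ 2 - ∑ i, ⟪v i, ∑ j, W i j • v j⟫) + α * ∑ i, f i (v i) ≤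
    1 / 2 * (∑ i, ‖u i‖ ^ 2 - ∑ i, ⟪u i, ∑ j, W i j • u j⟫) + α * ∑ i, f i (u i) := by
  obtain ⟨d, hd'⟩ : ∃ d : Fin n → EuclideanSpace ℝ (Fin p), ∀ i, v i = u i + d i :=
    ⟨fun i => v i - u i, fun i => by simp⟩
  have hq : ∑ i, ⟪v i, ∑ j, W i j • v j⟫ = ∑ i, ⟪u i, ∑ j, W i j • u j⟫
      + 2 * ∑ i, ⟪d i, ∑ j, W i j • u j⟫ + ∑ i, ⟪d i, ∑ j, W i j • d j⟫ := by
    have h0 := dgd_symm W hW u d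
    simp only [hd', smul_add, Finset.sum_add_distrib, inner_add_left, inner_add_right]
    linarith
  have hn2 : ∑ i, ‖v i‖ ^ 2 = ∑ i, ‖u i‖ ^ 2 + 2 * ∑ i, ⟪d i, u i⟫ + ∑ i, ‖d i‖ ^ 2 := by
    simp only [hd', norm_add_sq_real, Finset.sum_add_distrib, Finset.mul_sum]
    simp only [real_inner_comm]
  have hf : ∑ i, f i (v i) ≤ ∑ i, f i (u i) + ∑ i, ⟪d i, g i (u i)⟫ + L / 2 * ∑ i, ‖d i‖ ^ 2 := by
    rw [Finset.mul_sum, ← Finset.sum_add_distrib, ← Finset.sum_add_distrib]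
    refine Finset.sum_le_sum fun i _ => ?_
    have := hd i (u i) (v i)
    have e : v i - u i = d i := by rw [hd']; simp
    rw [e, real_inner_comm] at this
    exact this
  have hdd : ∑ i, ⟪d i, ∑ j, W i j • u j⟫ - ∑ i, ⟪d i, u i⟫ - α * ∑ i, ⟪d i, g i (u i)⟫
      = ∑ i, ‖d i‖ ^ 2 := by
    rw [Finset.mul_sum, ← Finset.sum_sub_distrib, ← Finset.sum_sub_distrib]
    refine Finset.sum_congr rfl fun i _ => ?_
    rw [← real_inner_smul_right, ← inner_sub_right, ← inner_sub_right, ← real_inner_self_eq_norm_sq]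
    congr 1
    have h1 := hv i
    rw [hd'] at h1
    rw [eq_sub_of_add_eq' h1]; abel
  have hlow := dgd_vlow W hW l hl d
  have hS : 0 ≤ ∑ i, ‖d i‖ ^ 2 := Finset.sum_nonneg fun _ _ => sq_nonneg _
  have hf' := mul_le_mul_of_nonneg_left hf hα.le
  have hs' := mul_le_mul_of_nonneg_right hs hS
  rw [hq, hn2]
  nlinarith

lemma dgd_mink (a b : Fin n → EuclideanSpace ℝ (Fin p)) (A B : ℝ) (hA : 0 ≤ A) (hB : 0 ≤ B)
    (ha : ∑ i, ‖a i‖ ^ 2 ≤ A ^ 2) (hb : ∑ i, ‖b i‖ ^ 2 ≤ B ^ 2) :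
    ∑ i, ‖a i - b i‖ ^ 2 ≤ (A + B) ^ 2 := by
  let a' : PiLp 2 (fun _ : Fin n => EuclideanSpace ℝ (Fin p)) := WithLp.toLp 2 a
  let b' : PiLp 2 (fun _ : Fin n => EuclideanSpace ℝ (Fin p)) := WithLp.toLp 2 b
  have h1 : ‖a'‖ ≤ A := by
    rw [← abs_of_nonneg hA, ← abs_norm, ← sq_le_sq, PiLp.norm_sq_eq_of_L2]; exact ha
  have h2 : ‖b'‖ ≤ B := by
    rw [← abs_of_nonneg hB, ← abs_norm, ← sq_le_sq, PiLp.norm_sq_eq_of_L2]; exact hb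
  have h3 : ‖a' - b'‖ ≤ A + B := (norm_sub_le _ _).trans (add_le_add h1 h2)
  have h4 := pow_le_pow_left₀ (norm_nonneg _) h3 2
  rw [PiLp.norm_sq_eq_of_L2] at h4
  exact h4

lemma dgd_var (hn : 0 < n) (a : Fin n → EuclideanSpace ℝ (Fin p)) :
    ∑ i, ‖a i - (n : ℝ)⁻¹ • ∑ j, a j‖ ^ 2 ≤ ∑ i, ‖a i‖ ^ 2 := by
  have hn' : (0 : ℝ) < n := by exact_mod_cast hn
  simp only [norm_sub_sq_real, Finset.sum_add_distrib, Finset.sum_sub_distrib, ← Finset.mul_sum,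
    ← sum_inner]
  rw [real_inner_smul_right, real_inner_self_eq_norm_sq, norm_smul, mul_pow]
  simp
  have : (n : ℝ) * ((n : ℝ)⁻¹ ^ 2 * ‖∑ j, a j‖ ^ 2) = (n : ℝ)⁻¹ * ‖∑ j, a j‖ ^ 2 := by field_simp
  have h2 : 0 ≤ (n : ℝ)⁻¹ * ‖∑ j, a j‖ ^ 2 := by positivity
  simp only [inv_pow] at this
  linarith
end vec

set_option maxHeartbeats 2000000 in
theorem mean_error_geometric_convergence
    {n p : ℕ} (hn : 0 < n)
    (f : Fin n → EuclideanSpace ℝ (Fin p) → ℝ)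
    (gf : Fin n → EuclideanSpace ℝ (Fin p) → EuclideanSpace ℝ (Fin p))
    (Lf : Fin n → ℝ) (hLfpos : ∀ i, 0 < Lf i)
    (hconv : ∀ i, ConvexOn ℝ Set.univ (f i))
    (hbdd : ∀ i, BddBelow (Set.range (f i)))
    (hgrad : ∀ i z, HasGradientAt (f i) (gf i z) z)
    (hlip : ∀ i, LipschitzWith (Lf i).toNNReal (gf i))
    (Lh : ℝ) (hLh : Lh = ⨆ i, Lf i)
    (W : Matrix (Fin n) (Fin n) ℝ)
    (hWsymm : W.IsHermitian)
    (hWnonneg : ∀ i j, 0 ≤ W i j)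
    (hWrow : ∀ i, ∑ j, W i j = 1)
    (hWcol : ∀ j, ∑ i, W i j = 1)
    (lam : Fin n → ℝ) (hlamAnti : Antitone lam)
    (hlamEig : ∃ σ : Equiv.Perm (Fin n), lam = hWsymm.eigenvalues ∘ σ)
    (hlam1 : lam ⟨0, hn⟩ = 1)
    (lamN : ℝ) (hlamN : lamN = lam ⟨n - 1, Nat.sub_lt hn Nat.one_pos⟩)
    (hlamNlb : -1 ≤ lamN)
    (β : ℝ) (hβdef : β = ⨆ j : {j : Fin n // j ≠ (⟨0, hn⟩ : Fin n)}, |lam j.1|)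
    (α : ℝ) (hα : 0 < α)
    (x : ℕ → Fin n → EuclideanSpace ℝ (Fin p))
    (hiter : ∀ k i, x (k + 1) i = (∑ j, W i j • x k j) - α • gf i (x k i))
    (hx0 : ∀ i, x 0 i = 0)
    (D : ℝ) (hD : D = Real.sqrt (2 * Lh * ((∑ i, f i 0) - ∑ i, ⨅ z, f i z)))
    (xbar : ℕ → EuclideanSpace ℝ (Fin p)) (hxbar : ∀ k, xbar k = (n : ℝ)⁻¹ • ∑ i, x k i)
    (Lfbar : ℝ) (hLfbar : Lfbar = (n : ℝ)⁻¹ * ∑ i, Lf i)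
    (xstar : EuclideanSpace ℝ (Fin p)) (hxstar : ∀ z, ∑ i, f i xstar ≤ ∑ i, f i z)
    (μf : ℝ) (hμf : 0 < μf)
    (hsc : ∀ a b : EuclideanSpace ℝ (Fin p), μf * ‖a - b‖ ^ 2 ≤ ⟪(∑ i, gf i a) - (∑ i, gf i b), a - b⟫)
    (μfbar : ℝ) (hμfbar : μfbar = μf / n)
    (c₁ : ℝ) (hc1 : c₁ = 1 / (μfbar + Lfbar))
    (c₂ : ℝ) (hc2 : c₂ = μfbar * Lfbar / (μfbar + Lfbar))
    (ebar : ℕ → EuclideanSpace ℝ (Fin p)) (hebar : ∀ k, ebar k = xbar k - xstar)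
    (c₃ : ℝ) (hc3 : c₃ = Real.sqrt (1 - α * c₂ / 2))
    (hstep : α ≤ min ((1 + lamN) / Lh) c₁)
    (hβlt : β < 1)
 :
    c₃ ∈ Set.Ioo (0 : ℝ) 1 ∧
    ∀ k, ‖ebar k‖
      ≤ c₃ ^ k * ‖ebar 0‖
        + (α * Lh * D / (1 - β)) * Real.sqrt (4 / c₂ ^ 2 - 2 * α / c₂) := by
  have hn' : (0 : ℝ) < n := by exact_mod_cast hn
  have : Nonempty (Fin n) := ⟨⟨0, hn⟩⟩
  obtain ⟨σ, hσ⟩ := hlamEig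
  have heig : ∀ j, hWsymm.eigenvalues j = lam (σ.symm j) := by
    intro j; rw [hσ]; simp
  have hlow : ∀ j, lamN ≤ hWsymm.eigenvalues j := by
    intro j; rw [heig, hlamN]; apply hlamAnti
    rw [Fin.le_def]; have := (σ.symm j).2; simp only; omega
  have hup : ∀ j, hWsymm.eigenvalues j ≤ 1 := by
    intro j; rw [heig, ← hlam1]; apply hlamAnti
    rw [Fin.le_def]; simp
  have hβ0 : 0 ≤ β := by rw [hβdef]; exact Real.iSup_nonneg fun _ => abs_nonneg _
  have hβb : ∀ j, j ≠ σ ⟨0, hn⟩ → |hWsymm.eigenvalues j| ≤ β := by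
    intro j hj
    rw [heig, hβdef]
    have hne : σ.symm j ≠ ⟨0, hn⟩ := by
      intro h; apply hj; rw [← h]; simp
    exact le_ciSup (f := fun j : {j : Fin n // j ≠ (⟨0, hn⟩ : Fin n)} => |lam j.1|)
      (Set.finite_range _).bddAbove ⟨σ.symm j, hne⟩
  have hLi : ∀ i, Lf i ≤ Lh := fun i => by
    rw [hLh]; exact le_ciSup (Set.finite_range _).bddAbove i
  have hLhpos : 0 < Lh := (hLfpos ⟨0, hn⟩).trans_le (hLi _)
  have hlip' : ∀ i a b, ‖gf i a - gf i b‖ ≤ Lf i * ‖a - b‖ := by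
    intro i a b
    have := (hlip i).norm_sub_le a b
    rwa [Real.coe_toNNReal _ (hLfpos i).le] at this
  have hdesc : ∀ i x y, f i y ≤ f i x + ⟪gf i x, y - x⟫ + Lf i / 2 * ‖y - x‖ ^ 2 :=
    fun i x y => dgd_descent (f i) (gf i) (Lf i) (hgrad i) (hlip' i) x y
  have hdesc' : ∀ i x y, f i y ≤ f i x + ⟪gf i x, y - x⟫ + Lh / 2 * ‖y - x‖ ^ 2 := by
    intro i x y
    have := hdesc i x y
    nlinarith [hLi i, sq_nonneg ‖y - x‖]
  have hfirst : ∀ i x y, f i x + ⟪gf i x, y - x⟫ ≤ f i y :=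
    fun i x y => dgd_first (f i) (gf i) (hgrad i) (hconv i) x y
  have hs1 : α * Lh ≤ 1 + lamN := (le_div_iff₀ hLhpos).1 (hstep.trans (min_le_left _ _))
  have hs2 : α ≤ c₁ := hstep.trans (min_le_right _ _)
  -- gradient bound
  have hly : ∀ k, 1 / 2 * (∑ i, ‖x k i‖ ^ 2 - ∑ i, ⟪x k i, ∑ j, W i j • x k j⟫)
      + α * ∑ i, f i (x k i) ≤ α * ∑ i, f i 0 := by
    intro k
    induction k with
    | zero => simp [hx0]
    | succ k ih =>
      exact (dgd_lyap W hWsymm lamN hlow f gf Lh α hα hdesc' hs1 (x k) (x (k + 1)) (hiter k)).trans ih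
  have hfk : ∀ k, ∑ i, f i (x k i) ≤ ∑ i, f i 0 := by
    intro k
    have h1 := hly k
    have h2 := dgd_vup W hWsymm hup (x k)
    exact le_of_mul_le_mul_left (by linarith) hα
  have hinf : ∀ i z, (⨅ z, f i z) ≤ f i z := fun i z => ciInf_le (hbdd i) z
  have hgk : ∀ k, ∑ i, ‖gf i (x k i)‖ ^ 2 ≤ D ^ 2 := by
    intro k
    have h1 : ∑ i, ‖gf i (x k i)‖ ^ 2 ≤ ∑ i, 2 * Lh * (f i (x k i) - ⨅ z, f i z) :=
      Finset.sum_le_sum fun i _ => dgd_gradbd (f i) (gf i) Lh hLhpos (hdesc' i) _ (hinf i) _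
    rw [← Finset.mul_sum, Finset.sum_sub_distrib] at h1
    have h3 : 0 ≤ ∑ i, f i 0 - ∑ i, ⨅ z, f i z :=
      sub_nonneg.2 (Finset.sum_le_sum fun i _ => hinf i 0)
    rw [hD, Real.sq_sqrt (by positivity)]
    refine h1.trans (mul_le_mul_of_nonneg_left ?_ (by positivity))
    linarith [hfk k]
  have hD0 : 0 ≤ D := by rw [hD]; exact Real.sqrt_nonneg _
  have h1β : 0 < 1 - β := by linarith
  -- mean iteration
  have hmean : ∀ k, xbar (k + 1) = xbar k - α • ((n : ℝ)⁻¹ • ∑ i, gf i (x k i)) := by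
    intro k
    rw [hxbar, hxbar]
    simp only [hiter, Finset.sum_sub_distrib, ← Finset.smul_sum]
    rw [Finset.sum_comm]
    simp only [← Finset.sum_smul, hWcol, one_smul]
    rw [smul_sub, smul_comm]
  have hsum0 : ∀ k, ∑ i, (x k i - xbar k) = 0 := by
    intro k
    rw [Finset.sum_sub_distrib, Finset.sum_const, hxbar]
    simp only [Finset.card_univ, Fintype.card_fin]
    rw [← Nat.cast_smul_eq_nsmul ℝ, smul_smul, mul_inv_cancel₀ hn'.ne', one_smul, sub_self]
  have hdev : ∀ k, ∑ i, ‖x k i - xbar k‖ ^ 2 ≤ (α * D / (1 - β)) ^ 2 := by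
    intro k
    induction k with
    | zero =>
      have : xbar 0 = 0 := by rw [hxbar]; simp [hx0]
      simp only [this, hx0, sub_zero, norm_zero]
      simp; positivity
    | succ k ih =>
      have e : ∀ i, x (k + 1) i - xbar (k + 1) = (∑ j, W i j • (x k j - xbar k))
          - α • (gf i (x k i) - (n : ℝ)⁻¹ • ∑ j, gf j (x k j)) := by
        intro i
        rw [hiter, hmean]
        simp only [smul_sub, Finset.sum_sub_distrib, ← Finset.sum_smul, hWrow, one_smul]
        abel
      have h1 := dgd_vcontr W hWsymm hWrow hn (σ ⟨0, hn⟩) β hβlt hβb (fun j => x k j - xbar k) (hsum0 k)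
      have h2 := (dgd_var hn (fun i => gf i (x k i))).trans (hgk k)
      have h3 := dgd_mink (fun i => ∑ j, W i j • (x k j - xbar k))
        (fun i => α • (gf i (x k i) - (n : ℝ)⁻¹ • ∑ j, gf j (x k j)))
        (β * (α * D / (1 - β))) (α * D) (by positivity) (by positivity)
        (by
          refine h1.trans ?_
          rw [mul_pow]
          exact mul_le_mul_of_nonneg_left ih (sq_nonneg _))
        (by
          simp only [norm_smul, mul_pow, ← Finset.mul_sum, Real.norm_eq_abs, sq_abs]
          exact mul_le_mul_of_nonneg_left h2 (sq_nonneg _))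
      have h4 : β * (α * D / (1 - β)) + α * D = α * D / (1 - β) := by
        field_simp; ring
      rw [h4] at h3
      simp only [e]
      exact h3
  have hdev' : ∀ k i, ‖x k i - xbar k‖ ≤ α * D / (1 - β) := by
    intro k i
    have h1 : ‖x k i - xbar k‖ ^ 2 ≤ (α * D / (1 - β)) ^ 2 :=
      (Finset.single_le_sum (f := fun i => ‖x k i - xbar k‖ ^ 2) (fun _ _ => sq_nonneg _)
        (Finset.mem_univ i)).trans (hdev k)
    exact le_of_sq_le_sq h1 (by positivity)
  set Er := α * Lh * D / (1 - β) with hEr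
  have hEr0 : 0 ≤ Er := by positivity
  have hgerr : ∀ k, ‖(n : ℝ)⁻¹ • ∑ i, gf i (xbar k) - (n : ℝ)⁻¹ • ∑ i, gf i (x k i)‖ ≤ Er := by
    intro k
    rw [← smul_sub, ← Finset.sum_sub_distrib, norm_smul, Real.norm_of_nonneg (by positivity)]
    have h1 : ‖∑ i, (gf i (xbar k) - gf i (x k i))‖ ≤ ∑ _i : Fin n, Er := by
      refine (norm_sum_le _ _).trans (Finset.sum_le_sum fun i _ => ?_)
      refine (hlip' i _ _).trans ?_
      rw [norm_sub_rev]
      refine (mul_le_mul (hLi i) (hdev' k i) (norm_nonneg _) hLhpos.le).trans (le_of_eq ?_)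
      rw [hEr]; ring
    simp only [Finset.sum_const, Finset.card_univ, Fintype.card_fin, nsmul_eq_mul] at h1
    calc (n : ℝ)⁻¹ * ‖∑ i, (gf i (xbar k) - gf i (x k i))‖ ≤ (n : ℝ)⁻¹ * (n * Er) := by gcongr
      _ = Er := by field_simp
  -- constants
  have hLb : ∑ i, Lf i = n * Lfbar := by rw [hLfbar]; field_simp
  have hsumL : 0 < ∑ i, Lf i := Finset.sum_pos (fun i _ => hLfpos i) Finset.univ_nonempty
  have hLbpos : 0 < Lfbar := by rw [hLfbar]; positivity
  have hμpos : 0 < μfbar := by rw [hμfbar]; positivity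
  have hμn : μf = n * μfbar := by rw [hμfbar]; field_simp
  have hc2pos : 0 < c₂ := by rw [hc2]; positivity
  have hc2μ : c₂ ≤ μfbar := by
    rw [hc2, div_le_iff₀ (by positivity)]; nlinarith
  have hc2L : c₂ ≤ Lfbar := by
    rw [hc2, div_le_iff₀ (by positivity)]; nlinarith
  have hαL : α * (μfbar + Lfbar) ≤ 1 := by
    rw [hc1] at hs2
    exact (le_div_iff₀ (by positivity)).1 hs2
  have hαc2 : α * c₂ ≤ 1 / 2 := by nlinarith
  have hαc2pos : 0 < α * c₂ := by positivity
  -- sum function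
  have hFd : ∀ a b, ∑ i, f i b ≤ ∑ i, f i a + ⟪∑ i, gf i a, b - a⟫ + (∑ i, Lf i) / 2 * ‖b - a‖ ^ 2 := by
    intro a b
    rw [sum_inner, Finset.sum_div, Finset.sum_mul, ← Finset.sum_add_distrib, ← Finset.sum_add_distrib]
    exact Finset.sum_le_sum fun i _ => hdesc i a b
  have hFc : ∀ a b, ∑ i, f i a + ⟪∑ i, gf i a, b - a⟫ ≤ ∑ i, f i b := by
    intro a b
    rw [sum_inner, ← Finset.sum_add_distrib]
    exact Finset.sum_le_sum fun i _ => hfirst i a b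
  have hG0 : ∑ i, gf i xstar = 0 := by
    have := dgd_gradbd (fun z => ∑ i, f i z) (fun z => ∑ i, gf i z) _ hsumL hFd
      (∑ i, f i xstar) hxstar xstar
    simp only [sub_self, mul_zero] at this
    exact norm_eq_zero.1 (pow_eq_zero_iff two_ne_zero |>.1 (le_antisymm this (sq_nonneg _)))
  have hcontr : ∀ k, ‖ebar k - α • ((n : ℝ)⁻¹ • ∑ i, gf i (xbar k))‖ ≤ Real.sqrt (1 - α * c₂) * ‖ebar k‖ := by
    intro k
    have h1 := dgd_coco (fun z => ∑ i, f i z) (fun z => ∑ i, gf i z) _ hsumL hFd hFc (xbar k) xstar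
    have h2 := hsc (xbar k) xstar
    simp only [hG0, sub_zero, ← hebar] at h1 h2
    rw [hLb] at h1
    rw [hμn] at h2
    set G := ∑ i, gf i (xbar k) with hG
    set e := ebar k with he
    have hI : μfbar * ‖e‖ ^ 2 ≤ (n : ℝ)⁻¹ * ⟪G, e⟫ := by
      rw [inv_mul_eq_div, le_div_iff₀ hn']; linarith
    have hJ : ((n : ℝ)⁻¹ * ‖G‖) ^ 2 ≤ Lfbar * ((n : ℝ)⁻¹ * ⟪G, e⟫) := by
      have : (n : ℝ)⁻¹ ^ 2 * ‖G‖ ^ 2 ≤ (n : ℝ)⁻¹ ^ 2 * (n * Lfbar * ⟪G, e⟫) := by gcongr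
      rw [mul_pow]
      refine this.trans (le_of_eq ?_)
      field_simp
    refine le_of_sq_le_sq ?_ (by positivity)
    rw [mul_pow, Real.sq_sqrt (by linarith), norm_sub_sq_real, real_inner_smul_right,
      real_inner_smul_right, norm_smul, norm_smul, Real.norm_of_nonneg hα.le,
      Real.norm_of_nonneg (inv_pos.2 hn').le, real_inner_comm]
    set P := (n : ℝ)⁻¹ * ⟪G, e⟫
    have hP : 0 ≤ P := le_trans (by positivity) hI
    rw [mul_pow]
    have k1 := mul_le_mul_of_nonneg_left hJ (sq_nonneg α)
    have k2 : α ^ 2 * (Lfbar * P) ≤ α * P := by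
      have h5 : α * Lfbar ≤ 1 := by
        have := mul_pos hα hμpos
        linarith
      have h6 := mul_le_mul_of_nonneg_right h5 (mul_nonneg hα.le hP)
      calc α ^ 2 * (Lfbar * P) = α * Lfbar * (α * P) := by ring
        _ ≤ 1 * (α * P) := h6
        _ = α * P := one_mul _
    have k3 : α * c₂ * ‖e‖ ^ 2 ≤ α * P := by
      rw [mul_assoc]
      refine mul_le_mul_of_nonneg_left (le_trans ?_ hI) hα.le
      gcongr
    linarith
  set q := Real.sqrt (1 - α * c₂) with hq
  have hq0 : 0 ≤ q := Real.sqrt_nonneg _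
  have hqsq : q ^ 2 = 1 - α * c₂ := Real.sq_sqrt (by linarith)
  have hq1 : q ≤ 1 := by nlinarith
  have hqc : q ≤ c₃ := by rw [hc3]; exact Real.sqrt_le_sqrt (by linarith)
  have hc30 : 0 < c₃ := by rw [hc3]; exact Real.sqrt_pos.2 (by linarith)
  set R := Real.sqrt (4 / c₂ ^ 2 - 2 * α / c₂) with hR
  have hR1 : (1 + q) / c₂ ≤ R := by
    refine Real.le_sqrt_of_sq_le ?_
    have e : 4 / c₂ ^ 2 - 2 * α / c₂ = (4 - 2 * (α * c₂)) / c₂ ^ 2 := by field_simp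
    rw [e, div_pow]
    gcongr
    nlinarith [sq_nonneg (1 - q)]
  have hR2 : q * R + α ≤ R := by
    have h1 := mul_le_mul_of_nonneg_left hR1 (sub_nonneg.2 hq1)
    have h2 : (1 - q) * ((1 + q) / c₂) = α := by
      rw [← mul_div_assoc, div_eq_iff hc2pos.ne']; nlinarith
    linarith
  have hR0 : 0 ≤ R := Real.sqrt_nonneg _
  refine ⟨⟨hc30, ?_⟩, ?_⟩
  · rw [hc3, Real.sqrt_lt' one_pos]; linarith
  intro k
  induction k with
  | zero => simp; positivity
  | succ k ih =>
    have e : ebar (k + 1) = (ebar k - α • ((n : ℝ)⁻¹ • ∑ i, gf i (xbar k)))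
        + α • ((n : ℝ)⁻¹ • ∑ i, gf i (xbar k) - (n : ℝ)⁻¹ • ∑ i, gf i (x k i)) := by
      rw [hebar, hebar, hmean, smul_sub]; abel
    have h1 : ‖ebar (k + 1)‖ ≤ q * ‖ebar k‖ + α * Er := by
      rw [e]
      refine (norm_add_le _ _).trans (add_le_add (hcontr k) ?_)
      rw [norm_smul, Real.norm_of_nonneg hα.le]
      exact mul_le_mul_of_nonneg_left (hgerr k) hα.le
    have h2 := mul_le_mul_of_nonneg_left ih hq0
    have h3 : q * (c₃ ^ k * ‖ebar 0‖) ≤ c₃ * (c₃ ^ k * ‖ebar 0‖) :=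
      mul_le_mul_of_nonneg_right hqc (by positivity)
    have h4 := mul_le_mul_of_nonneg_left hR2 hEr0
    rw [pow_succ]
    linarith
end
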